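/- For any real number r with 0 < r < 1/2, there exist positive constants c and C such that for every pair of positive integers n, j with r ≤ j/n ≤ 1−r, one has (c/√(2π(n−j)))·φ(j/n)^n ≤ n^{−n}·a(n,j) ≤ (C/√(2π(n−j)))·φ(j/n)^n. -/

import Mathlib

noncomputable def stirling2 (n j : ℕ) : ℝ :=
  (1 / (Nat.factorial j : ℝ)) *
    ∑ i ∈ Finset.range (j + 1), (-1 : ℝ) ^ i * (Nat.choose j i : ℝ) * ((j - i : ℕ) : ℝ) ^ n

noncomputable def a (n j : ℕ) : ℝ :=
  (Nat.choose n j : ℝ) * (Nat.factorial j : ℝ) * stirling2 n j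

noncomputable def varphi (x : ℝ) : ℝ := x ^ (-x) * (1 - x) ^ (-(1 - x))

noncomputable def phi (δ : ℝ → ℝ) (x : ℝ) : ℝ :=
  (Real.exp 1 * Real.log (1 + Real.exp (-(δ x))))⁻¹ * varphi x * Real.exp (-(x * δ x))

theorem norm_pow_sub_pow_le_mul {x y : ℂ} {q : ℝ} (hx : ‖x‖ ≤ q) (hy : ‖y‖ ≤ q) (j : ℕ) :
    ‖x ^ j - y ^ j‖ ≤ j * q ^ (j - 1) * ‖x - y‖ := by
  have hq : 0 ≤ q := (norm_nonneg x).trans hx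
  rw [← geom_sum₂_mul, norm_mul]
  gcongr
  refine (norm_sum_le _ _).trans ?_
  calc ∑ i ∈ Finset.range j, ‖x ^ i * y ^ (j - 1 - i)‖
      ≤ ∑ i ∈ Finset.range j, q ^ (j - 1) := by
        refine Finset.sum_le_sum fun i hi => ?_
        have hi' : i ≤ j - 1 := by have := Finset.mem_range.1 hi; omega
        rw [norm_mul, norm_pow, norm_pow]
        calc ‖x‖ ^ i * ‖y‖ ^ (j - 1 - i) ≤ q ^ i * q ^ (j - 1 - i) := by gcongr
          _ = q ^ (j - 1) := by rw [← pow_add]; congr 1; omega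
    _ = j * q ^ (j - 1) := by simp

theorem interval_gaussian_le {b : ℝ} (hb : 0 < b) :
    ∫ t in (-Real.pi)..Real.pi, Real.exp (-b * t ^ 2) ≤ Real.sqrt (Real.pi / b) := by
  rw [← integral_gaussian, intervalIntegral.integral_of_le (by linarith [Real.pi_pos])]
  exact MeasureTheory.setIntegral_le_integral (integrable_exp_neg_mul_sq hb)
    (Filter.Eventually.of_forall fun t => (Real.exp_pos _).le)

theorem le_interval_gaussian {b : ℝ} {j : ℕ} (hj : 0 < j) (hb : 0 ≤ b) :
    2 * Real.exp (-b) / Real.sqrt j ≤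
      ∫ t in (-Real.pi)..Real.pi, Real.exp (-(b * j) * t ^ 2) := by
  have hj' : (0 : ℝ) < j := by exact_mod_cast hj
  have hs : 0 < Real.sqrt j := Real.sqrt_pos.2 hj'
  have hs1 : 1 ≤ Real.sqrt j := by
    rw [Real.one_le_sqrt]; exact_mod_cast hj
  have hpi := Real.pi_gt_three
  set u : ℝ := (Real.sqrt j)⁻¹ with hu
  have hu0 : 0 < u := inv_pos.2 hs
  have hu1 : u ≤ 1 := inv_le_one_of_one_le₀ hs1
  have huj : u ^ 2 * j = 1 := by
    rw [hu, inv_pow, Real.sq_sqrt hj'.le, inv_mul_cancel₀ hj'.ne']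
  have hcont : Continuous fun t : ℝ => Real.exp (-(b * j) * t ^ 2) := by fun_prop
  calc 2 * Real.exp (-b) / Real.sqrt j = ∫ t in (-u)..u, Real.exp (-b) := by
        rw [intervalIntegral.integral_const, smul_eq_mul, hu]; ring
    _ ≤ ∫ t in (-u)..u, Real.exp (-(b * j) * t ^ 2) := by
        refine intervalIntegral.integral_mono_on (by linarith) (by simp)
          (hcont.intervalIntegrable _ _) fun t ht => ?_
        apply Real.exp_le_exp.2
        have : t ^ 2 ≤ u ^ 2 := sq_le_sq' ht.1 ht.2
        have : t ^ 2 * j ≤ 1 := by rw [← huj]; gcongr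
        nlinarith
    _ ≤ _ := by
        refine intervalIntegral.integral_mono_interval (by linarith) (by linarith) (by linarith)
          (Filter.Eventually.of_forall fun t => (Real.exp_pos _).le) (hcont.intervalIntegrable _ _)

theorem abs_pow_three_mul_exp_le {b : ℝ} (hb : 0 < b) (t : ℝ) :
    |t| ^ 3 * Real.exp (-b * t ^ 2) ≤ (Real.sqrt b ^ 3)⁻¹ * Real.exp (-(b / 4) * t ^ 2) := by
  have hs : 0 < Real.sqrt b := Real.sqrt_pos.2 hb
  set y := Real.sqrt b * |t| with hy
  have hy0 : 0 ≤ y := by positivity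
  have hy2 : y ^ 2 = b * t ^ 2 := by rw [hy, mul_pow, Real.sq_sqrt hb.le, sq_abs]
  have h1 : y ≤ Real.exp (b * t ^ 2 / 4) := by
    have := Real.add_one_le_exp (b * t ^ 2 / 4)
    nlinarith [sq_nonneg (y - 2)]
  have h3 : y ^ 3 ≤ Real.exp (3 * (b * t ^ 2 / 4)) := by
    have := pow_le_pow_left₀ hy0 h1 3
    rwa [← Real.exp_nat_mul] at this
  have : |t| ^ 3 = (Real.sqrt b ^ 3)⁻¹ * y ^ 3 := by
    rw [hy]; field_simp
  rw [this, mul_assoc]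
  gcongr
  calc y ^ 3 * Real.exp (-b * t ^ 2)
      ≤ Real.exp (3 * (b * t ^ 2 / 4)) * Real.exp (-b * t ^ 2) := by gcongr
    _ = _ := by rw [← Real.exp_add]; congr 1; ring

theorem norm_integral_pow_le {H : ℝ → ℂ} {κ : ℝ} (hκ : 0 < κ)
    (hH : ∀ t, |t| ≤ Real.pi → ‖H t‖ ≤ Real.exp (-κ * t ^ 2)) {j : ℕ} (hj : 0 < j) :
    ‖∫ t in (-Real.pi)..Real.pi, H t ^ j‖ ≤ Real.sqrt (Real.pi / κ) / Real.sqrt j := by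
  have hj' : (0 : ℝ) < j := by exact_mod_cast hj
  calc ‖∫ t in (-Real.pi)..Real.pi, H t ^ j‖
      ≤ ∫ t in (-Real.pi)..Real.pi, Real.exp (-(κ * j) * t ^ 2) := by
        refine intervalIntegral.norm_integral_le_of_norm_le (by linarith [Real.pi_pos])
          (Filter.Eventually.of_forall fun t ht => ?_)
          (Continuous.intervalIntegrable (by fun_prop) _ _)
        rw [norm_pow]
        refine (pow_le_pow_left₀ (norm_nonneg _) (hH t (abs_le.2 ⟨ht.1.le, ht.2⟩)) j).trans_eq ?_
        rw [← Real.exp_nat_mul]; congr 1; ring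
    _ ≤ Real.sqrt (Real.pi / (κ * j)) := interval_gaussian_le (by positivity)
    _ = _ := by rw [← div_div, Real.sqrt_div' _ hj'.le]

theorem norm_integral_pow_sub_gaussian_le {H : ℝ → ℂ} (hHc : Continuous H) {κ s K : ℝ}
    (hκ : 0 < κ) (hκs : κ ≤ s) (hK : 0 ≤ K)
    (hH : ∀ t, |t| ≤ Real.pi → ‖H t‖ ≤ Real.exp (-κ * t ^ 2))
    (hE : ∀ t, |t| ≤ Real.pi → ‖H t - (Real.exp (-s * t ^ 2) : ℝ)‖ ≤ K * |t| ^ 3)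
    {j : ℕ} (hj : 2 ≤ j) :
    ‖(∫ t in (-Real.pi)..Real.pi, H t ^ j) -
      ((∫ t in (-Real.pi)..Real.pi, Real.exp (-(s * j) * t ^ 2) : ℝ) : ℂ)‖ ≤
      8 * K * Real.sqrt Real.pi / κ ^ 2 / j := by
  have hj' : (2 : ℝ) ≤ j := by exact_mod_cast hj
  rw [← intervalIntegral.integral_ofReal, ← intervalIntegral.integral_sub
    (Continuous.intervalIntegrable (by fun_prop) _ _) (Continuous.intervalIntegrable (by fun_prop) _ _)]
  set b : ℝ := κ * (j - 1) with hb
  have hb0 : 0 < b := by rw [hb]; apply mul_pos hκ; linarith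
  have hsb : 0 < Real.sqrt b := Real.sqrt_pos.2 hb0
  have hbl : κ * j / 2 ≤ b := by rw [hb]; nlinarith
  clear_value b
  calc _ ≤ ∫ t in (-Real.pi)..Real.pi,
          (j * K * (Real.sqrt b ^ 3)⁻¹) * Real.exp (-(b / 4) * t ^ 2) := by
        refine intervalIntegral.norm_integral_le_of_norm_le (by linarith [Real.pi_pos])
          (Filter.Eventually.of_forall fun t ht => ?_)
          (Continuous.intervalIntegrable (by fun_prop) _ _)
        have ht' : |t| ≤ Real.pi := abs_le.2 ⟨ht.1.le, ht.2⟩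
        have hg : Real.exp (-(s * j) * t ^ 2) = Real.exp (-s * t ^ 2) ^ j := by
          rw [← Real.exp_nat_mul]; congr 1; ring
        have hy : ‖((Real.exp (-s * t ^ 2) : ℝ) : ℂ)‖ ≤ Real.exp (-κ * t ^ 2) := by
          rw [Complex.norm_real, Real.norm_of_nonneg (Real.exp_pos _).le]
          apply Real.exp_le_exp.2
          nlinarith [sq_nonneg t]
        rw [hg, Complex.ofReal_pow]
        refine (norm_pow_sub_pow_le_mul (hH t ht') hy j).trans ?_
        have hq : Real.exp (-κ * t ^ 2) ^ (j - 1) = Real.exp (-b * t ^ 2) := by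
          rw [← Real.exp_nat_mul, Nat.cast_sub (by omega), hb]; congr 1; push_cast; ring
        rw [hq]
        calc _ ≤ j * Real.exp (-b * t ^ 2) * (K * |t| ^ 3) := by gcongr; exact hE t ht'
          _ = j * K * (|t| ^ 3 * Real.exp (-b * t ^ 2)) := by ring
          _ ≤ j * K * ((Real.sqrt b ^ 3)⁻¹ * Real.exp (-(b / 4) * t ^ 2)) := by
            exact mul_le_mul_of_nonneg_left (abs_pow_three_mul_exp_le hb0 t) (by positivity)
          _ = _ := by ring
    _ ≤ (j * K * (Real.sqrt b ^ 3)⁻¹) * Real.sqrt (Real.pi / (b / 4)) := by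
        rw [intervalIntegral.integral_const_mul]
        gcongr
        exact interval_gaussian_le (by positivity)
    _ = j * K * 2 * Real.sqrt Real.pi / b ^ 2 := by
        have h4 : Real.pi / (b / 4) = Real.pi * 2 ^ 2 / b := by field_simp; norm_num
        rw [h4, Real.sqrt_div' _ hb0.le, Real.sqrt_mul Real.pi_pos.le,
          Real.sqrt_sq (by norm_num)]
        have : b ^ 2 = Real.sqrt b ^ 4 := by
          rw [show Real.sqrt b ^ 4 = (Real.sqrt b ^ 2) ^ 2 by ring, Real.sq_sqrt hb0.le]
        rw [this]; field_simp
    _ ≤ j * K * 2 * Real.sqrt Real.pi / (κ * j / 2) ^ 2 := by gcongr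
    _ = _ := by field_simp; norm_num

theorem local_limit_lower {H : ℝ → ℂ} (hHc : Continuous H) {κ s S K : ℝ}
    (hκ : 0 < κ) (hκs : κ ≤ s) (hsS : s ≤ S) (hK : 0 ≤ K)
    (hH : ∀ t, |t| ≤ Real.pi → ‖H t‖ ≤ Real.exp (-κ * t ^ 2))
    (hE : ∀ t, |t| ≤ Real.pi → ‖H t - (Real.exp (-s * t ^ 2) : ℝ)‖ ≤ K * |t| ^ 3)
    {j : ℕ} (hj : 2 ≤ j)
    (hj' : 8 * K * Real.sqrt Real.pi / κ ^ 2 ≤ Real.exp (-S) * Real.sqrt j) :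
    Real.exp (-S) / Real.sqrt j ≤ (∫ t in (-Real.pi)..Real.pi, H t ^ j).re := by
  have h1 := norm_integral_pow_sub_gaussian_le hHc hκ hκs hK hH hE hj
  have h2 := le_interval_gaussian (b := s) (j := j) (by omega) (by linarith)
  have h3 := (abs_le.1 ((Complex.abs_re_le_norm _).trans h1)).1
  rw [Complex.sub_re, Complex.ofReal_re] at h3
  have hj0 : (0 : ℝ) < j := by exact_mod_cast (by omega : 0 < j)
  have hs : 0 < Real.sqrt j := Real.sqrt_pos.2 hj0
  have h4 : 8 * K * Real.sqrt Real.pi / κ ^ 2 / j ≤ Real.exp (-S) / Real.sqrt j := by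
    calc _ ≤ Real.exp (-S) * Real.sqrt j / j := by gcongr
      _ = _ := by
        nth_rewrite 2 [← Real.sq_sqrt hj0.le]; field_simp
  have h5 : 2 * Real.exp (-S) / Real.sqrt j ≤ 2 * Real.exp (-s) / Real.sqrt j := by gcongr
  have h6 : 2 * Real.exp (-S) / Real.sqrt j =
    Real.exp (-S) / Real.sqrt j + Real.exp (-S) / Real.sqrt j := by ring
  linarith

/-- The number of surjections from an `n`-set onto a `j`-set, by inclusion-exclusion. -/
noncomputable def surjCount (n j : ℕ) : ℝ :=
  ∑ i ∈ Finset.range (j + 1), (-1 : ℝ) ^ i * (Nat.choose j i : ℝ) * ((j - i : ℕ) : ℝ) ^ n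

theorem surjCount_succ_succ (n j : ℕ) :
    surjCount (n + 1) (j + 1) = (j + 1) * (surjCount n (j + 1) + surjCount n j) := by
  have h1 : surjCount (n + 1) (j + 1) = (j + 1) * ∑ i ∈ Finset.range (j + 1),
      (-1 : ℝ) ^ i * (Nat.choose j i : ℝ) * ((j + 1 - i : ℕ) : ℝ) ^ n := by
    rw [surjCount, Finset.sum_range_succ, Finset.mul_sum]
    simp only [Nat.sub_self, Nat.cast_zero, ne_eq, Nat.succ_ne_zero, not_false_eq_true,
      zero_pow, mul_zero, add_zero]
    refine Finset.sum_congr rfl fun i _ => ?_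
    have h : (Nat.choose j i : ℝ) * (j + 1) = (Nat.choose (j + 1) i : ℝ) * ((j + 1 - i : ℕ) : ℝ) := by
      exact_mod_cast Nat.choose_mul_succ_eq j i
    rw [pow_succ]
    linear_combination (-1) * (-1 : ℝ) ^ i * ((j + 1 - i : ℕ) : ℝ) ^ n * h
  have h2 : surjCount n (j + 1) = (∑ i ∈ Finset.range (j + 1),
      (-1 : ℝ) ^ i * (Nat.choose j i : ℝ) * ((j + 1 - i : ℕ) : ℝ) ^ n) - surjCount n j := by
    rw [surjCount, Finset.sum_range_succ', surjCount]
    have : ∀ i ∈ Finset.range (j + 1), (-1 : ℝ) ^ (i + 1) * (Nat.choose (j + 1) (i + 1) : ℝ) *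
        ((j + 1 - (i + 1) : ℕ) : ℝ) ^ n =
        (-1 : ℝ) ^ (i + 1) * (Nat.choose j (i + 1) : ℝ) * ((j + 1 - (i + 1) : ℕ) : ℝ) ^ n -
        (-1 : ℝ) ^ i * (Nat.choose j i : ℝ) * ((j - i : ℕ) : ℝ) ^ n := by
      intro i _
      rw [Nat.choose_succ_succ, Nat.add_sub_add_right]
      push_cast
      ring
    rw [Finset.sum_congr rfl this, Finset.sum_sub_distrib]
    have h3 := Finset.sum_range_succ' (fun i => (-1 : ℝ) ^ i * (Nat.choose j i : ℝ) *
      ((j + 1 - i : ℕ) : ℝ) ^ n) (j + 1)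
    rw [Finset.sum_range_succ] at h3
    simp only [Nat.choose_succ_self, Nat.choose_zero_right, Nat.cast_zero, mul_zero,
      zero_mul, add_zero] at h3 ⊢
    linarith
  rw [h1, h2]; ring

theorem surjCount_nonneg (n j : ℕ) : 0 ≤ surjCount n j := by
  induction n generalizing j with
  | zero =>
    have h := Int.alternating_sum_range_choose (n := j)
    have : surjCount 0 j = ((∑ i ∈ Finset.range (j + 1), (-1) ^ i * (j.choose i : ℤ) : ℤ) : ℝ) := by
      simp [surjCount]
    rw [this, h]; split_ifs <;> simp
  | succ n ih =>
    cases j with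
    | zero => simp [surjCount]
    | succ j =>
      rw [surjCount_succ_succ]
      have := ih j
      have := ih (j + 1)
      positivity

theorem surjCount_pos {n j : ℕ} (hj : 0 < j) (hjn : j ≤ n) : 0 < surjCount n j := by
  induction n generalizing j with
  | zero => omega
  | succ n ih =>
    obtain ⟨j, rfl⟩ := Nat.exists_eq_succ_of_ne_zero hj.ne'
    rw [Nat.succ_eq_add_one, surjCount_succ_succ]
    have h1 := surjCount_nonneg n (j + 1)
    have h2 := surjCount_nonneg n j
    rcases Nat.eq_zero_or_pos j with rfl | hj0
    · rcases Nat.eq_zero_or_pos n with rfl | hn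
      · simp [surjCount, Finset.sum_range_succ]
      · have := ih (j := 1) one_pos hn
        simp only [zero_add] at *
        positivity
    · have := ih hj0 (by omega)
      positivity

theorem a_eq_choose_mul_surjCount (n j : ℕ) : a n j = Nat.choose n j * surjCount n j := by
  rw [a, stirling2, ← surjCount]
  have : (Nat.factorial j : ℝ) ≠ 0 := by positivity
  field_simp

theorem integral_exp_mul_exp (w : ℂ) (n : ℕ) :
    ∫ t in (-Real.pi)..Real.pi,
      Complex.exp (w * Complex.exp (t * Complex.I)) * Complex.exp (-(n * t * Complex.I)) =
      2 * Real.pi * w ^ n / n.factorial := by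
  have h := DiffContOnCl.circleIntegral_one_div_sub_center_pow_smul (R := 1) (c := 0) one_pos n
    (f := fun s => Complex.exp (w * s)) (Differentiable.diffContOnCl (by fun_prop))
  rw [iteratedDeriv_cexp_const_mul, circleIntegral] at h
  simp only [smul_eq_mul, mul_zero, Complex.exp_zero, mul_one, sub_zero] at h
  have hint : ∀ t : ℝ, deriv (circleMap 0 1) t *
      (1 / circleMap 0 1 t ^ (n + 1) * Complex.exp (w * circleMap 0 1 t)) =
      Complex.I * (Complex.exp (w * Complex.exp (t * Complex.I)) *
        Complex.exp (-(n * t * Complex.I))) := by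
    intro t
    have hc : circleMap 0 1 t = Complex.exp (t * Complex.I) := by simp [circleMap]
    have hn : Complex.exp (-(n * t * Complex.I)) = (Complex.exp (t * Complex.I) ^ n)⁻¹ := by
      rw [Complex.exp_neg, ← Complex.exp_nat_mul]; ring_nf
    have h0 := Complex.exp_ne_zero (t * Complex.I)
    rw [deriv_circleMap, hc, hn]
    field_simp
    rw [pow_succ']
  rw [intervalIntegral.integral_congr (fun t _ => hint t),
    intervalIntegral.integral_const_mul] at h
  have hper : Function.Periodic (fun t : ℝ => Complex.exp (w * Complex.exp (t * Complex.I)) *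
        Complex.exp (-(n * t * Complex.I))) (2 * Real.pi) := by
    intro t
    have h1 : Complex.exp (((t + 2 * Real.pi : ℝ) : ℂ) * Complex.I) =
        Complex.exp (t * Complex.I) := by
      rw [← Complex.exp_periodic (t * Complex.I)]; push_cast; ring_nf
    have h2 : ∀ u : ℝ, Complex.exp (-(n * u * Complex.I)) =
        (Complex.exp (u * Complex.I) ^ n)⁻¹ := by
      intro u
      rw [Complex.exp_neg, ← Complex.exp_nat_mul]; ring_nf
    simp only [h2, h1]
  have h3 := hper.intervalIntegral_add_eq 0 (-Real.pi)
  rw [zero_add, show -Real.pi + 2 * Real.pi = Real.pi by ring] at h3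
  rw [h3] at h
  apply mul_left_cancel₀ Complex.I_ne_zero
  rw [h]; ring

/-- The characteristic function of a Poisson variable of parameter `z` conditioned to be positive,
shifted by `μ`. -/
noncomputable def truncPoissonChar (z μ : ℝ) (t : ℝ) : ℂ :=
  (Complex.exp (z * Complex.exp (t * Complex.I)) - 1) / (Real.exp z - 1 : ℝ) *
    Complex.exp (-(μ * t * Complex.I))

theorem continuous_truncPoissonChar (z μ : ℝ) : Continuous (truncPoissonChar z μ) := by
  unfold truncPoissonChar
  fun_prop

theorem integral_truncPoissonChar_pow {z μ : ℝ} {n j : ℕ} (h : μ * j = n) :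
    ∫ t in (-Real.pi)..Real.pi, truncPoissonChar z μ t ^ j =
      ((2 * Real.pi * (surjCount n j * z ^ n / (n.factorial * (Real.exp z - 1) ^ j)) : ℝ) : ℂ) := by
  have hpt : ∀ t : ℝ, truncPoissonChar z μ t ^ j = ∑ i ∈ Finset.range (j + 1),
      ((-1) ^ i * (j.choose i : ℂ) / ((Real.exp z - 1 : ℝ) : ℂ) ^ j) *
      (Complex.exp ((((j - i : ℕ) : ℂ) * z) * Complex.exp (t * Complex.I)) *
        Complex.exp (-(n * t * Complex.I))) := by
    intro t
    have h1 : Complex.exp (-(μ * t * Complex.I)) ^ j = Complex.exp (-(n * t * Complex.I)) := by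
      have : (μ : ℂ) * j = n := by exact_mod_cast h
      rw [← Complex.exp_nat_mul, ← this]; ring_nf
    rw [truncPoissonChar, mul_pow, div_pow, h1, sub_eq_neg_add, add_pow, Finset.sum_div,
      Finset.sum_mul]
    refine Finset.sum_congr rfl fun i _ => ?_
    rw [mul_assoc ((j - i : ℕ) : ℂ), Complex.exp_nat_mul]
    ring
  rw [intervalIntegral.integral_congr (fun t _ => hpt t), intervalIntegral.integral_finsetSum
    (fun i _ => Continuous.intervalIntegrable (by fun_prop) _ _)]
  simp only [intervalIntegral.integral_const_mul, integral_exp_mul_exp]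
  rw [surjCount]
  push_cast
  rw [Finset.sum_mul, Finset.sum_div, Finset.mul_sum]
  refine Finset.sum_congr rfl fun i _ => ?_
  rw [mul_pow]
  field_simp

theorem norm_one_add_mul_exp_le {b : ℝ} (hb : 0 ≤ b) (t : ℝ) :
    ‖1 + (b : ℂ) * Complex.exp (t * Complex.I)‖ ≤ 1 + b - b / (1 + b) * (1 - Real.cos t) := by
  have hb1 : 0 < 1 + b := by linarith
  have hc1 := Real.neg_one_le_cos t
  have hc2 := Real.cos_le_one t
  have hq : b / (1 + b) * (1 + b) = b := div_mul_cancel₀ _ hb1.ne'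
  have hq0 : 0 ≤ b / (1 + b) := by positivity
  have hq1 : b / (1 + b) * 2 ≤ 1 + b := by
    rw [div_mul_eq_mul_div, div_le_iff₀ hb1]; nlinarith
  refine abs_le_of_sq_le_sq' ?_ (by nlinarith) |>.2
  rw [← Complex.normSq_eq_norm_sq, Complex.exp_mul_I, ← Complex.ofReal_cos, ← Complex.ofReal_sin,
    Complex.normSq_apply]
  simp only [Complex.add_re, Complex.one_re, Complex.mul_re, Complex.ofReal_re, Complex.ofReal_im,
    Complex.I_re, Complex.I_im, Complex.add_im, Complex.one_im, Complex.mul_im]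
  have e : (1 + b - b / (1 + b) * (1 - Real.cos t)) ^ 2 =
      (1 + b) ^ 2 - 2 * b * (1 - Real.cos t) + (b / (1 + b) * (1 - Real.cos t)) ^ 2 := by
    linear_combination (-2) * (1 - Real.cos t) * hq
  have := sq_nonneg (b / (1 + b) * (1 - Real.cos t))
  rw [e]
  refine le_of_eq_of_le (b := (1 + b) ^ 2 - 2 * b * (1 - Real.cos t)) ?_ (by linarith)
  linear_combination b ^ 2 * Real.sin_sq_add_cos_sq t

theorem norm_truncPoissonChar_le {z : ℝ} (hz : 0 < z) (μ : ℝ) {t : ℝ} (ht : |t| ≤ Real.pi) :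
    ‖truncPoissonChar z μ t‖ ≤
      1 - z ^ 2 / (2 + z) * (2 / Real.pi ^ 2) / (Real.exp z - 1) * t ^ 2 := by
  have hD : 0 < Real.exp z - 1 := by linarith [Real.add_one_lt_exp hz.ne']
  set w : ℂ := z * Complex.exp (t * Complex.I) with hw
  have hwn : ‖w‖ = z := by
    rw [hw, norm_mul, Complex.norm_exp_ofReal_mul_I, Complex.norm_real, Real.norm_of_nonneg hz.le,
      mul_one]
  have h1 := Complex.norm_exp_sub_sum_le_exp_norm_sub_sum w 3
  simp only [hwn, Finset.sum_range_succ, Finset.sum_range_zero, zero_add, pow_zero,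
    Nat.factorial_zero, Nat.cast_one, div_one, pow_one, Nat.factorial_one, Nat.factorial_two,
    Nat.cast_ofNat] at h1
  have h2 : ‖w + w ^ 2 / 2‖ ≤ z * (1 + z / 2 - (z / 2) / (1 + z / 2) * (1 - Real.cos t)) := by
    have : w + w ^ 2 / 2 = w * (1 + ((z / 2 : ℝ) : ℂ) * Complex.exp (t * Complex.I)) := by
      rw [hw]; push_cast; ring
    rw [this, norm_mul, hwn]
    gcongr
    exact norm_one_add_mul_exp_le (by positivity) t
  have hcos := Real.cos_le_one_sub_mul_cos_sq ht
  have h3 : ‖Complex.exp w - 1‖ ≤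
      Real.exp z - 1 - z ^ 2 / (2 + z) * (2 / Real.pi ^ 2 * t ^ 2) := by
    have e1 : Complex.exp w - 1 = (Complex.exp w - (1 + w + w ^ 2 / 2)) + (w + w ^ 2 / 2) := by
      ring
    have e2 : z * ((z / 2) / (1 + z / 2) * (1 - Real.cos t)) =
        z ^ 2 / (2 + z) * (1 - Real.cos t) := by field_simp
    have e3 : z ^ 2 / (2 + z) * (2 / Real.pi ^ 2 * t ^ 2) ≤ z ^ 2 / (2 + z) * (1 - Real.cos t) := by
      gcongr; linarith
    rw [e1]
    refine (norm_add_le _ _).trans ?_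
    linarith
  have h4 : ‖Complex.exp (-(μ * t * Complex.I))‖ = 1 := by
    have : -(μ * t * Complex.I) = ((-(μ * t) : ℝ) : ℂ) * Complex.I := by push_cast; ring
    rw [this, Complex.norm_exp_ofReal_mul_I]
  rw [truncPoissonChar, norm_mul, h4, mul_one, norm_div, Complex.norm_real,
    Real.norm_of_nonneg hD.le, div_le_iff₀ hD]
  refine h3.trans_eq ?_
  field_simp

theorem norm_exp_sub_taylor_two_le (w : ℂ) :
    ‖Complex.exp w - 1 - w‖ ≤ ‖w‖ ^ 2 * Real.exp ‖w‖ := by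
  have := Complex.norm_exp_sub_sum_le_norm_mul_exp w 2
  simpa [Finset.sum_range_succ, sub_sub] using this

theorem norm_exp_sub_taylor_three_le (w : ℂ) :
    ‖Complex.exp w - 1 - w - w ^ 2 / 2‖ ≤ ‖w‖ ^ 3 * Real.exp ‖w‖ := by
  have := Complex.norm_exp_sub_sum_le_norm_mul_exp w 3
  simpa [Finset.sum_range_succ, sub_sub, Nat.factorial_two, add_assoc] using this

theorem norm_truncPoissonChar_sub_taylor_le {z μ M : ℝ} (hz : 0 < z) (hzM : z ≤ M) (hμ0 : 0 ≤ μ)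
    (hμM : μ ≤ M) (hμ : z * Real.exp z = μ * (Real.exp z - 1)) {t : ℝ} (ht : |t| ≤ Real.pi) :
    ‖truncPoissonChar z μ t - (1 - μ * (z + 1 - μ) / 2 * t ^ 2 : ℝ)‖ ≤
      (Real.exp M * (M * Real.exp Real.pi + 2 * M ^ 2 * Real.exp Real.pi +
        8 * M ^ 3 * Real.exp (2 * M * Real.pi)) + M ^ 3 * Real.exp (M * Real.pi)) / z *
        |t| ^ 3 := by
  have hDz : z ≤ Real.exp z - 1 := by linarith [Real.add_one_le_exp z]
  have hD : 0 < Real.exp z - 1 := by linarith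
  have hM : 0 < M := by linarith
  set θ : ℂ := t * Complex.I with hθ
  have hθn : ‖θ‖ = |t| := by rw [hθ, norm_mul, Complex.norm_I, mul_one, Complex.norm_real,
    Real.norm_eq_abs]
  have ht2 : (t : ℂ) ^ 2 = -θ ^ 2 := by rw [hθ, mul_pow, Complex.I_sq]; ring
  set r3 := Complex.exp θ - 1 - θ - θ ^ 2 / 2 with hr3
  set r2 := Complex.exp θ - 1 - θ with hr2
  set w : ℂ := z * (Complex.exp θ - 1) - μ * θ with hw
  set p : ℂ := (z - μ) * θ with hp
  set q3 := Complex.exp w - 1 - w - w ^ 2 / 2 with hq3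
  set u3 := Complex.exp (-(μ * θ)) - 1 - (-(μ * θ)) - (-(μ * θ)) ^ 2 / 2 with hu3
  have br3 : ‖r3‖ ≤ |t| ^ 3 * Real.exp Real.pi := by
    refine (norm_exp_sub_taylor_three_le θ).trans ?_
    rw [hθn]; gcongr
  have br2 : ‖r2‖ ≤ |t| ^ 2 * Real.exp Real.pi := by
    refine (norm_exp_sub_taylor_two_le θ).trans ?_
    rw [hθn]; gcongr
  have bz : ‖(z : ℂ)‖ ≤ M := by rwa [Complex.norm_real, Real.norm_of_nonneg hz.le]
  have bμ : ‖(μ : ℂ)‖ ≤ M := by rwa [Complex.norm_real, Real.norm_of_nonneg hμ0]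
  have bμθ : ‖-(μ * θ)‖ ≤ M * |t| := by
    rw [norm_neg, norm_mul, hθn]; gcongr
  have bp : ‖p‖ ≤ M * |t| := by
    have : ‖((z : ℂ) - μ)‖ ≤ M := by
      rw [← Complex.ofReal_sub, Complex.norm_real, Real.norm_eq_abs, abs_le]
      constructor <;> linarith
    rw [hp, norm_mul, hθn]; gcongr
  have bw : ‖w‖ ≤ 2 * M * |t| := by
    have h1 : ‖Complex.exp θ - 1‖ ≤ |t| := by
      have := Real.norm_exp_I_mul_ofReal_sub_one_le (x := t)
      rwa [mul_comm] at this
    calc ‖w‖ ≤ ‖(z : ℂ) * (Complex.exp θ - 1)‖ + ‖(μ : ℂ) * θ‖ := norm_sub_le _ _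
      _ ≤ M * |t| + M * |t| := by
        rw [norm_mul, norm_mul, hθn]; gcongr
      _ = _ := by ring
  have bq3 : ‖q3‖ ≤ (2 * M * |t|) ^ 3 * Real.exp (2 * M * Real.pi) := by
    refine (norm_exp_sub_taylor_three_le w).trans ?_
    gcongr
    exact bw.trans (by gcongr)
  have bu3 : ‖u3‖ ≤ (M * |t|) ^ 3 * Real.exp (M * Real.pi) := by
    refine (norm_exp_sub_taylor_three_le _).trans ?_
    gcongr
    exact bμθ.trans (by gcongr)
  have hexp : Complex.exp z * Complex.exp w = Complex.exp (z * Complex.exp θ) *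
      Complex.exp (-(μ * θ)) := by
    rw [← Complex.exp_add, ← Complex.exp_add, hw]; ring_nf
  have hDC : (Complex.exp z - 1 : ℂ) ≠ 0 := by exact_mod_cast hD.ne'
  have hμC : (z : ℂ) * Complex.exp z = μ * (Complex.exp z - 1) := by exact_mod_cast hμ
  have hmul : truncPoissonChar z μ t * (Complex.exp z - 1) =
      Complex.exp z * Complex.exp w - Complex.exp (-(μ * θ)) := by
    rw [hexp, truncPoissonChar, ← hθ, mul_assoc (μ : ℂ), ← hθ, Complex.ofReal_sub,
      Complex.ofReal_exp, Complex.ofReal_one]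
    field_simp
  have hew : Complex.exp w = 1 + w + w ^ 2 / 2 + q3 := by rw [hq3]; ring
  have heu : Complex.exp (-(μ * θ)) = 1 - μ * θ + μ ^ 2 * θ ^ 2 / 2 + u3 := by rw [hu3]; ring
  have hw1 : w = p + z * (θ ^ 2 / 2 + r3) := by rw [hw, hp, hr3]; ring
  have hw2 : w ^ 2 = p ^ 2 + z * r2 * (w + p) := by
    have : w - p = z * r2 := by rw [hw, hp, hr2]; ring
    rw [← this]; ring
  have key : (truncPoissonChar z μ t - (1 - μ * (z + 1 - μ) / 2 * t ^ 2 : ℝ)) *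
      (Complex.exp z - 1) =
      Complex.exp z * (z * r3 + z * r2 * (w + p) / 2 + q3) - u3 := by
    push_cast
    rw [sub_mul, hmul, heu, hew, hw2, ht2]
    have hw3 : Complex.exp z * (1 + w) = Complex.exp z * (1 + (p + z * (θ ^ 2 / 2 + r3))) := by
      rw [← hw1]
    rw [hp] at hw3 ⊢
    linear_combination hw3 + (θ + θ ^ 2 / 2 * (1 + z - 2 * μ)) * hμC
  have hDn : ‖(Complex.exp z - 1 : ℂ)‖ = Real.exp z - 1 := by
    rw [← Complex.ofReal_exp, ← Complex.ofReal_one, ← Complex.ofReal_sub, Complex.norm_real,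
      Real.norm_of_nonneg hD.le]
  have hez : ‖Complex.exp z‖ ≤ Real.exp M := by
    rw [← Complex.ofReal_exp, Complex.norm_real, Real.norm_of_nonneg (Real.exp_pos _).le]
    exact Real.exp_le_exp.2 hzM
  rw [div_mul_eq_mul_div _ z, le_div_iff₀ hz]
  calc _ ≤ ‖truncPoissonChar z μ t - (1 - μ * (z + 1 - μ) / 2 * t ^ 2 : ℝ)‖ *
        (Real.exp z - 1) := by gcongr
    _ = ‖Complex.exp z * (z * r3 + z * r2 * (w + p) / 2 + q3) - u3‖ := by
      rw [← key, norm_mul, hDn]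
    _ ≤ ‖Complex.exp z‖ * (‖(z : ℂ)‖ * ‖r3‖ + ‖(z : ℂ)‖ * ‖r2‖ * (‖w‖ + ‖p‖) / 2 + ‖q3‖) + ‖u3‖ := by
      refine (norm_sub_le _ _).trans ?_
      rw [norm_mul]
      gcongr
      refine (norm_add_le _ _).trans ?_
      gcongr
      refine (norm_add_le _ _).trans ?_
      rw [norm_mul, norm_div, norm_mul, norm_mul, Complex.norm_ofNat]
      gcongr
      exact norm_add_le _ _
    _ ≤ Real.exp M * (M * (|t| ^ 3 * Real.exp Real.pi) + M * (|t| ^ 2 * Real.exp Real.pi) *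
        (2 * M * |t| + 2 * M * |t|) / 2 + (2 * M * |t|) ^ 3 * Real.exp (2 * M * Real.pi)) +
        (M * |t|) ^ 3 * Real.exp (M * Real.pi) := by
      have bp' : ‖p‖ ≤ 2 * M * |t| := bp.trans (by nlinarith [abs_nonneg t])
      gcongr
    _ = _ := by ring

theorem abs_exp_neg_sub_one_sub_le {y : ℝ} (hy : 0 ≤ y) :
    |Real.exp (-y) - (1 - y)| ≤ y ^ 2 := by
  have h1 := Real.add_one_le_exp (-y)
  have h2 : Real.exp (-y) ≤ (1 + y)⁻¹ := by
    rw [Real.exp_neg]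
    exact inv_anti₀ (by linarith) (by linarith [Real.add_one_le_exp y])
  have h3 : (1 + y)⁻¹ ≤ 1 - y + y ^ 2 := by
    rw [inv_le_iff_one_le_mul₀ (by linarith)]
    nlinarith [pow_nonneg hy 3]
  rw [abs_le]
  constructor <;> nlinarith [sq_nonneg y]

theorem le_of_quadratic_bound {κ s K T : ℝ} (hT : 0 < T) (hK : 0 ≤ K)
    (h : ∀ t, |t| ≤ T → 1 - s * t ^ 2 - K * |t| ^ 3 ≤ 1 - κ * t ^ 2) : κ ≤ s := by
  by_contra! hlt
  have hd : 0 < κ - s := by linarith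
  set t := min T ((κ - s) / (K + 1)) with ht
  have ht0 : 0 < t := lt_min hT (by positivity)
  have h1 : t * (K + 1) ≤ κ - s := by
    rw [← le_div_iff₀ (by positivity)]; exact min_le_right _ _
  have h2 := h t (by rw [abs_of_pos ht0]; exact min_le_left _ _)
  rw [abs_of_pos ht0] at h2
  have h3 : t ^ 2 * (κ - s) ≤ t ^ 2 * (K * t) := by nlinarith
  have h4 := le_of_mul_le_mul_left h3 (by positivity)
  linarith

theorem exists_uniform_gaussian_comparison {z₀ M : ℝ} (hz₀ : 0 < z₀) (hM : z₀ ≤ M) :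
    ∃ κ S K : ℝ, 0 < κ ∧ 0 ≤ K ∧ ∀ z μ : ℝ, z₀ ≤ z → z ≤ M → 0 ≤ μ → μ ≤ M →
      z * Real.exp z = μ * (Real.exp z - 1) → ∃ s, κ ≤ s ∧ s ≤ S ∧
        (∀ t, |t| ≤ Real.pi → ‖truncPoissonChar z μ t‖ ≤ Real.exp (-κ * t ^ 2)) ∧
        ∀ t, |t| ≤ Real.pi →
          ‖truncPoissonChar z μ t - (Real.exp (-s * t ^ 2) : ℝ)‖ ≤ K * |t| ^ 3 := by
  have hpi := Real.pi_pos
  have hM0 : 0 < M := by linarith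
  have hDM : 0 < Real.exp M - 1 := by linarith [Real.add_one_lt_exp hM0.ne']
  set κ : ℝ := z₀ ^ 2 / (2 + M) * (2 / Real.pi ^ 2) / (Real.exp M - 1) with hκ
  set S : ℝ := M * (M + 1) / 2 with hS
  set K₁ : ℝ := (Real.exp M * (M * Real.exp Real.pi + 2 * M ^ 2 * Real.exp Real.pi +
        8 * M ^ 3 * Real.exp (2 * M * Real.pi)) + M ^ 3 * Real.exp (M * Real.pi)) / z₀ with hK₁
  have hK₁0 : 0 ≤ K₁ := by positivity
  refine ⟨κ, S, K₁ + S ^ 2 * Real.pi, by positivity, by positivity, ?_⟩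
  intro z μ hz hzM hμ0 hμM hμ
  have hz0 : 0 < z := by linarith
  have hDz : 0 < Real.exp z - 1 := by linarith [Real.add_one_lt_exp hz0.ne']
  have hH : ∀ t, |t| ≤ Real.pi → ‖truncPoissonChar z μ t‖ ≤ 1 - κ * t ^ 2 := by
    intro t ht
    refine (norm_truncPoissonChar_le hz0 μ ht).trans ?_
    rw [hκ]
    gcongr
  have hT : ∀ t, |t| ≤ Real.pi →
      ‖truncPoissonChar z μ t - (1 - μ * (z + 1 - μ) / 2 * t ^ 2 : ℝ)‖ ≤ K₁ * |t| ^ 3 := by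
    intro t ht
    refine (norm_truncPoissonChar_sub_taylor_le hz0 hzM hμ0 hμM hμ ht).trans ?_
    rw [hK₁]
    gcongr
  set s : ℝ := μ * (z + 1 - μ) / 2 with hs
  have hsS : s ≤ S := by
    rw [hs, hS]
    have : μ * (z + 1 - μ) ≤ μ * (M + 1) := by gcongr; linarith
    have : μ * (M + 1) ≤ M * (M + 1) := by gcongr
    linarith
  have hκs : κ ≤ s := by
    refine le_of_quadratic_bound hpi hK₁0 fun t ht => ?_
    have h1 := (Complex.abs_re_le_norm _).trans (hT t ht)
    rw [Complex.sub_re, Complex.ofReal_re, abs_le] at h1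
    have h2 := (Complex.re_le_norm _).trans (hH t ht)
    linarith [h1.1]
  have hs0 : 0 ≤ s := le_trans (by positivity) hκs
  refine ⟨s, hκs, hsS, fun t ht => (hH t ht).trans ?_, fun t ht => ?_⟩
  · have := Real.add_one_le_exp (-κ * t ^ 2)
    linarith
  · have h1 : ‖((1 - s * t ^ 2 : ℝ) : ℂ) - (Real.exp (-s * t ^ 2) : ℝ)‖ ≤
        S ^ 2 * Real.pi * |t| ^ 3 := by
      rw [← Complex.ofReal_sub, Complex.norm_real, Real.norm_eq_abs, abs_sub_comm, neg_mul]
      refine (abs_exp_neg_sub_one_sub_le (by positivity)).trans ?_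
      calc (s * t ^ 2) ^ 2 = s ^ 2 * |t| * |t| ^ 3 := by
            rw [← sq_abs t]; ring
        _ ≤ S ^ 2 * Real.pi * |t| ^ 3 := by gcongr
    calc _ ≤ ‖truncPoissonChar z μ t - (1 - s * t ^ 2 : ℝ)‖ +
          ‖((1 - s * t ^ 2 : ℝ) : ℂ) - (Real.exp (-s * t ^ 2) : ℝ)‖ := norm_sub_le_norm_sub_add_norm_sub _ _ _
      _ ≤ K₁ * |t| ^ 3 + S ^ 2 * Real.pi * |t| ^ 3 := add_le_add (hT t ht) h1
      _ = _ := by ring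

theorem exists_surjCount_bounds {z₀ M : ℝ} (hz₀ : 0 < z₀) (hM : z₀ ≤ M) :
    ∃ (c C : ℝ) (J : ℕ), 0 < c ∧ 0 < C ∧ ∀ (z μ : ℝ) (n j : ℕ), z₀ ≤ z → z ≤ M → 0 ≤ μ → μ ≤ M →
      z * Real.exp z = μ * (Real.exp z - 1) → 0 < j → μ * j = n →
      surjCount n j * z ^ n / (n.factorial * (Real.exp z - 1) ^ j) * Real.sqrt j ≤ C ∧
      (J ≤ j →
        c ≤ surjCount n j * z ^ n / (n.factorial * (Real.exp z - 1) ^ j) * Real.sqrt j) := by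
  obtain ⟨κ, S, K, hκ, hK, h⟩ := exists_uniform_gaussian_comparison hz₀ hM
  have hpi := Real.pi_pos
  obtain ⟨J, hJ⟩ := exists_nat_ge ((8 * K * Real.sqrt Real.pi / κ ^ 2 / Real.exp (-S)) ^ 2)
  refine ⟨Real.exp (-S) / (2 * Real.pi), Real.sqrt (Real.pi / κ) / (2 * Real.pi), max 2 J,
    by positivity, by positivity, ?_⟩
  intro z μ n j hz hzM hμ0 hμM hμ hj hμj
  obtain ⟨s, hκs, hsS, hH, hE⟩ := h z μ hz hzM hμ0 hμM hμ
  have hj0 : (0 : ℝ) < j := by exact_mod_cast hj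
  have hsj : 0 < Real.sqrt j := Real.sqrt_pos.2 hj0
  have hint := integral_truncPoissonChar_pow (z := z) hμj
  set P := surjCount n j * z ^ n / (n.factorial * (Real.exp z - 1) ^ j)
  constructor
  · have h1 := norm_integral_pow_le hκ hH hj
    rw [hint, Complex.norm_real] at h1
    have h2 := (Real.le_norm_self _).trans h1
    rw [le_div_iff₀ hsj] at h2
    rw [le_div_iff₀ (by positivity)]
    linarith
  · intro hJj
    have h1 := local_limit_lower (continuous_truncPoissonChar z μ) hκ hκs hsS hK hH hE
      (le_trans (le_max_left _ _) hJj) (by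
        rw [← div_le_iff₀' (Real.exp_pos _)]
        apply Real.le_sqrt_of_sq_le
        refine hJ.trans ?_
        exact_mod_cast le_trans (le_max_right _ _) hJj)
    rw [hint, Complex.ofReal_re, div_le_iff₀ hsj] at h1
    rw [div_le_iff₀ (by positivity)]
    linarith

theorem exists_pos_le_of_pos {ι : Type*} (t : Finset ι) (F : ι → ℝ) :
    ∃ c : ℝ, 0 < c ∧ ∀ p ∈ t, 0 < F p → c ≤ F p := by
  classical
  induction t using Finset.induction_on with
  | empty => exact ⟨1, one_pos, by simp⟩
  | insert p t _ ih =>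
    obtain ⟨c, hc, h⟩ := ih
    by_cases hp : 0 < F p
    · refine ⟨min c (F p), lt_min hc hp, fun q hq hq0 => ?_⟩
      rcases Finset.mem_insert.1 hq with rfl | hq
      · exact min_le_right _ _
      · exact (min_le_left _ _).trans (h q hq hq0)
    · refine ⟨c, hc, fun q hq hq0 => ?_⟩
      rcases Finset.mem_insert.1 hq with rfl | hq
      · exact absurd hq0 hp
      · exact h q hq hq0

theorem exists_factorial_eq {m : ℕ} (hm : 0 < m) :
    ∃ σ : ℝ, 1 ≤ σ ∧ σ ≤ Real.exp 1 ∧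
      (m.factorial : ℝ) = σ * Real.sqrt m * (m ^ m * Real.exp (-m)) := by
  have hm' : (0 : ℝ) < m := by exact_mod_cast hm
  have h2 : (0 : ℝ) < Real.sqrt 2 := by positivity
  refine ⟨Real.sqrt 2 * Stirling.stirlingSeq m, ?_, ?_, ?_⟩
  · have h1 := Stirling.sqrt_pi_le_stirlingSeq hm.ne'
    have h3 : 1 ≤ Real.sqrt Real.pi := by
      rw [Real.one_le_sqrt]; linarith [Real.pi_gt_three]
    have h4 : 1 ≤ Real.sqrt 2 := by rw [Real.one_le_sqrt]; norm_num
    exact one_le_mul_of_one_le_of_one_le h4 (h3.trans h1)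
  · have h1 := Stirling.stirlingSeq'_antitone (Nat.zero_le (m - 1))
    simp only [Function.comp_apply, Nat.succ_eq_add_one, Nat.sub_add_cancel hm, zero_add,
      Stirling.stirlingSeq_one] at h1
    rwa [le_div_iff₀' h2] at h1
  · rw [Stirling.stirlingSeq, Real.sqrt_mul zero_le_two, div_pow, ← Real.exp_nat_mul, mul_one,
      Real.exp_neg]
    field_simp

theorem varphi_pow {n j : ℕ} (hj : 0 < j) (hjn : j < n) :
    varphi ((j : ℝ) / n) ^ n = n ^ n / (j ^ j * ((n - j : ℕ) : ℝ) ^ (n - j)) := by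
  have hn' : (0 : ℝ) < n := by exact_mod_cast (hj.trans hjn)
  have hj' : (0 : ℝ) < j := by exact_mod_cast hj
  have hm' : (0 : ℝ) < ((n - j : ℕ) : ℝ) := by exact_mod_cast (by omega : 0 < n - j)
  have key : ∀ k : ℕ, 0 < k → (((k : ℝ) / n) ^ (-((k : ℝ) / n))) ^ n = n ^ k / k ^ k := by
    intro k hk
    rw [← Real.rpow_natCast, ← Real.rpow_mul (by positivity), neg_mul, div_mul_cancel₀ _ hn'.ne',
      Real.rpow_neg (by positivity), Real.rpow_natCast, div_pow, inv_div]
  have h1 : 1 - (j : ℝ) / n = ((n - j : ℕ) : ℝ) / n := by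
    rw [Nat.cast_sub hjn.le]; field_simp
  rw [varphi, mul_pow, h1, key j hj, key (n - j) (by omega), div_mul_div_comm, ← pow_add,
    Nat.add_sub_cancel' hjn.le]

theorem phi_pow {δ : ℝ → ℝ} {n j : ℕ} (hj : 0 < j) (hjn : j < n) {z : ℝ}
    (hz : z = Real.log (1 + Real.exp (-(δ ((j : ℝ) / n))))) :
    phi δ ((j : ℝ) / n) ^ n =
      Real.exp (-n) * n ^ n * (Real.exp z - 1) ^ j /
        (z ^ n * (j ^ j * ((n - j : ℕ) : ℝ) ^ (n - j))) := by
  have hn' : (0 : ℝ) < n := by exact_mod_cast (hj.trans hjn)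
  have hez : Real.exp z - 1 = Real.exp (-(δ ((j : ℝ) / n))) := by
    rw [hz, Real.exp_log (by positivity)]; ring
  have he : Real.exp (-((j : ℝ) / n * δ ((j : ℝ) / n))) ^ n = (Real.exp z - 1) ^ j := by
    rw [hez, ← Real.exp_nat_mul, ← Real.exp_nat_mul]
    congr 1; field_simp
  rw [phi, mul_pow, mul_pow, he, varphi_pow hj hjn, ← hz, mul_inv, mul_pow, ← Real.exp_neg,
    ← Real.exp_nat_mul, mul_neg_one, inv_pow]
  ring

theorem rpow_neg_mul_a_eq {δ : ℝ → ℝ} {n j : ℕ} (hj : 0 < j) (hjn : j < n) {z : ℝ} (hz0 : 0 < z)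
    (hz : z = Real.log (1 + Real.exp (-(δ ((j : ℝ) / n))))) :
    ∃ θ : ℝ, Real.exp (-2) ≤ θ ∧ θ ≤ Real.exp 2 ∧
      (n : ℝ) ^ (-(n : ℝ)) * a n j =
        θ * (n / j) * (surjCount n j * z ^ n / (n.factorial * (Real.exp z - 1) ^ j) *
          Real.sqrt j) / Real.sqrt (n - j) * phi δ ((j : ℝ) / n) ^ n := by
  have hn' : (0 : ℝ) < n := by exact_mod_cast (hj.trans hjn)
  have hj' : (0 : ℝ) < j := by exact_mod_cast hj
  obtain ⟨m, hm, rfl⟩ : ∃ m : ℕ, 0 < m ∧ n = j + m := ⟨n - j, by omega, by omega⟩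
  have hm' : (0 : ℝ) < m := by exact_mod_cast hm
  have hD : 0 < Real.exp z - 1 := by linarith [Real.add_one_lt_exp hz0.ne']
  obtain ⟨σn, hn1, hn2, hnf⟩ := exists_factorial_eq (m := j + m) (by omega)
  obtain ⟨σj, hj1, hj2, hjf⟩ := exists_factorial_eq hj
  obtain ⟨σm, hm1, hm2, hmf⟩ := exists_factorial_eq hm
  refine ⟨σn ^ 2 / (σj * σm), ?_, ?_, ?_⟩
  · rw [Real.exp_neg, inv_eq_one_div]
    have : σj * σm ≤ Real.exp 2 := by
      rw [show (2 : ℝ) = 1 + 1 by norm_num, Real.exp_add]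
      gcongr
    gcongr
    exact one_le_pow₀ hn1
  · rw [div_le_iff₀ (by positivity)]
    have h1 : σn ^ 2 ≤ Real.exp 2 := by
      rw [show (2 : ℝ) = 1 + 1 by norm_num, Real.exp_add, ← sq]
      gcongr
    have h2 : 1 ≤ σj * σm := one_le_mul_of_one_le_of_one_le hj1 hm1
    exact h1.trans (le_mul_of_one_le_right (Real.exp_pos _).le h2)
  · have hch : ((j + m).choose j : ℝ) = (j + m).factorial / (j.factorial * m.factorial) := by
      rw [Nat.cast_add_choose]
    have hexp : Real.exp (-((j + m : ℕ) : ℝ)) = Real.exp (-(j : ℝ)) * Real.exp (-(m : ℝ)) := by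
      rw [← Real.exp_add]; push_cast; ring_nf
    have hsq : Real.sqrt ((j + m : ℕ) : ℝ) ^ 2 = ((j + m : ℕ) : ℝ) := Real.sq_sqrt hn'.le
    have hsj : Real.sqrt j ^ 2 = j := Real.sq_sqrt hj'.le
    have hsub : ((j + m : ℕ) : ℝ) - j = m := by push_cast; ring
    have hsjp : 0 < Real.sqrt j := Real.sqrt_pos.2 hj'
    have hsmp : 0 < Real.sqrt m := Real.sqrt_pos.2 hm'
    have hsnp : 0 < Real.sqrt ((j + m : ℕ) : ℝ) := Real.sqrt_pos.2 hn'
    rw [a_eq_choose_mul_surjCount, phi_pow hj hjn hz, hch, hsub, Nat.add_sub_cancel_left,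
      Real.rpow_neg hn'.le, Real.rpow_natCast]
    generalize surjCount (j + m) j = s
    rw [hnf, hjf, hmf, hexp]
    generalize Real.exp z - 1 = D at *
    generalize ((j + m : ℕ) : ℝ) = N at *
    have hNN : N / j = Real.sqrt N ^ 2 / Real.sqrt j ^ 2 := by rw [hsq, hsj]
    rw [hNN]
    field_simp

theorem saddle_point_bounds {z μ : ℝ} (hz : 0 < z) (hμ : z * Real.exp z = μ * (Real.exp z - 1)) :
    z ≤ μ ∧ μ - 1 ≤ z := by
  have h1 := Real.add_one_le_exp z
  have hD : 0 < Real.exp z - 1 := by linarith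
  constructor
  · refine le_of_mul_le_mul_right ?_ hD
    linarith
  · refine le_of_mul_le_mul_right (a := Real.exp z - 1) ?_ hD
    linarith

theorem stmt_18 (δ : ℝ → ℝ)
    (hδ : ∀ x ∈ Set.Ioo (0 : ℝ) 1,
      (1 + Real.exp (δ x)) * Real.log (1 + Real.exp (-(δ x))) = 1 / x)
    (r : ℝ) (hr0 : 0 < r) (hr1 : r < 1 / 2) :
    ∃ c C : ℝ, 0 < c ∧ 0 < C ∧
      ∀ n j : ℕ, 0 < n → 0 < j → r ≤ (j : ℝ) / n → (j : ℝ) / n ≤ 1 - r →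
        c / Real.sqrt (2 * Real.pi * ((n : ℝ) - j)) * phi δ ((j : ℝ) / n) ^ n ≤
          (n : ℝ) ^ (-(n : ℝ)) * a n j ∧
        (n : ℝ) ^ (-(n : ℝ)) * a n j ≤
          C / Real.sqrt (2 * Real.pi * ((n : ℝ) - j)) * phi δ ((j : ℝ) / n) ^ n := by
  have hr1' : 0 < 1 - r := by linarith
  have hrM : r ≤ 1 / r := by
    rw [le_div_iff₀ hr0]; nlinarith
  obtain ⟨c₁, C, J, hc₁, hC, hbd⟩ := exists_surjCount_bounds hr0 hrM
  set G : ℕ × ℕ → ℝ := fun p =>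
    surjCount p.1 p.2 * Real.log (1 + Real.exp (-(δ ((p.2 : ℝ) / p.1)))) ^ p.1 /
      (p.1.factorial * (Real.exp (Real.log (1 + Real.exp (-(δ ((p.2 : ℝ) / p.1))))) - 1) ^ p.2) *
      Real.sqrt p.2 with hG
  obtain ⟨N, hN⟩ := exists_nat_gt ((J : ℝ) / r)
  obtain ⟨c₂, hc₂, hfin⟩ := exists_pos_le_of_pos (Finset.range N ×ˢ Finset.range J) G
  set c := min c₁ c₂ with hc
  have hc0 : 0 < c := lt_min hc₁ hc₂
  have h2pi : 0 < Real.sqrt (2 * Real.pi) := by positivity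
  refine ⟨Real.sqrt (2 * Real.pi) * (Real.exp (-2) * c),
    Real.sqrt (2 * Real.pi) * (Real.exp 2 * (1 / r) * C), by positivity, by positivity, ?_⟩
  intro n j hn hj hrj hjr
  have hn' : (0 : ℝ) < n := by exact_mod_cast hn
  have hj' : (0 : ℝ) < j := by exact_mod_cast hj
  have hx0 : 0 < (j : ℝ) / n := by positivity
  have hx1 : (j : ℝ) / n < 1 := by linarith
  have hjn' : (j : ℝ) < n := by rwa [div_lt_one hn'] at hx1
  have hjn : j < n := by exact_mod_cast hjn'
  have hnj : (n : ℝ) / j ≤ 1 / r := by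
    rw [← one_div_div]; exact one_div_le_one_div_of_le hr0 hrj
  have hnj1 : 1 ≤ (n : ℝ) / j := by rw [one_le_div hj']; exact hjn'.le
  obtain ⟨z, hz⟩ : ∃ z, z = Real.log (1 + Real.exp (-(δ ((j : ℝ) / n)))) := ⟨_, rfl⟩
  have hδp := Real.exp_pos (-(δ ((j : ℝ) / n)))
  have hz0 : 0 < z := by rw [hz]; apply Real.log_pos; linarith
  have hez : Real.exp z = 1 + Real.exp (-(δ ((j : ℝ) / n))) := by
    rw [hz, Real.exp_log (by positivity)]
  have hμ : z * Real.exp z = n / j * (Real.exp z - 1) := by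
    have h := hδ _ ⟨hx0, hx1⟩
    rw [← hz, one_div_div] at h
    have hinv : Real.exp (δ ((j : ℝ) / n)) * Real.exp (-(δ ((j : ℝ) / n))) = 1 := by
      rw [← Real.exp_add]; simp
    rw [hez, ← h]
    linear_combination (-z) * hinv
  obtain ⟨hzμ, hμz⟩ := saddle_point_bounds hz0 hμ
  have hzr : r ≤ z := by
    have : 1 + r ≤ (n : ℝ) / j := by
      rw [← one_div_div, le_div_iff₀ hx0]
      nlinarith
    linarith
  have hD : 0 < Real.exp z - 1 := by linarith [Real.add_one_lt_exp hz0.ne']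
  obtain ⟨hup, hlow⟩ := hbd z (n / j) n j hzr (hzμ.trans hnj) (by positivity) hnj hμ hj
    (div_mul_cancel₀ _ hj'.ne')
  obtain ⟨θ, hθ1, hθ2, heq⟩ := rpow_neg_mul_a_eq hj hjn hz0 hz
  have hGnj : G (n, j) = surjCount n j * z ^ n / (n.factorial * (Real.exp z - 1) ^ j) *
      Real.sqrt j := by rw [hG, hz]
  have hGpos : 0 < G (n, j) := by
    rw [hGnj]
    have := surjCount_pos hj hjn.le
    have := Real.sqrt_pos.2 hj'
    positivity
  rw [← hGnj] at heq hup hlow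
  have hcG : c ≤ G (n, j) := by
    rcases le_or_gt J j with hJ | hJ
    · exact (min_le_left _ _).trans (hlow hJ)
    · refine (min_le_right _ _).trans (hfin _ ?_ hGpos)
      rw [Finset.mem_product, Finset.mem_range, Finset.mem_range]
      refine ⟨?_, hJ⟩
      have h1 : (n : ℝ) ≤ j / r := by
        rw [le_div_iff₀ hr0]
        rw [le_div_iff₀ hn'] at hrj
        linarith
      have h2 : (j : ℝ) / r ≤ J / r := by gcongr
      exact_mod_cast (h1.trans h2).trans_lt hN
  have hphi : 0 ≤ phi δ ((j : ℝ) / n) ^ n := by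
    rw [phi_pow hj hjn hz]; positivity
  have hθ0 : 0 < θ := (Real.exp_pos _).trans_le hθ1
  rw [heq, Real.sqrt_mul (by positivity : (0 : ℝ) ≤ 2 * Real.pi), mul_div_mul_left _ _ h2pi.ne',
    mul_div_mul_left _ _ h2pi.ne']
  constructor
  · gcongr
    calc Real.exp (-2) ≤ θ := hθ1
      _ ≤ θ * (n / j) := le_mul_of_one_le_right hθ0.le hnj1
  · gcongr
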